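/- Let F ∈ 𝓕₁(I) be strictly increasing. Then there exists a function κ_F : {0,1,…,m} → {1,…,m} such that for every i ∈ {0,1,…,m} there exists K ∈ Λ(F) satisfying: (i) F^(κ_F(i))(I_i) ⊆ K; (ii) F^k(I_i) ⊄ K for all 1 ≤ k ≤ κ_F(i)−1; and (iii) F^p(I_i) ∩ F^q(I_i) = ∅ whenever 1 ≤ p ≠ q ≤ κ_F(i). -/

import Mathlib

open Set Filter Topology

/-- Iterates of a multifunction: `Iter F 0 x = {x}`, `Iter F (n+1) x = F (Iter F n x)`. -/
def Iter (F : ℝ → Set ℝ) : ℕ → ℝ → Set ℝ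
  | 0 => fun x => {x}
  | n + 1 => fun x => ⋃ y ∈ Iter F n x, F y

/-- Composition of multifunctions: `(G ∘ F)(x) = ⋃ y ∈ F x, G y`. -/
def Comp (G F : ℝ → Set ℝ) : ℝ → Set ℝ := fun x => ⋃ y ∈ F x, G y

/-- Image of a set under a multifunction: `F(A) = ⋃ x ∈ A, F x`. -/
def ImageOf (F : ℝ → Set ℝ) (A : Set ℝ) : Set ℝ := ⋃ x ∈ A, F x

/-- `F` is a multifunction on `[a,b]`: nonempty compact values contained in `[a,b]`. -/
def MFOn (a b : ℝ) (F : ℝ → Set ℝ) : Prop :=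
  ∀ x ∈ Icc a b, (F x).Nonempty ∧ IsCompact (F x) ∧ F x ⊆ Icc a b

/-- Upper semicontinuity of a multifunction at a point, relative to a domain `S`. -/
def USCWithin (S : Set ℝ) (F : ℝ → Set ℝ) (x : ℝ) : Prop :=
  ∀ V : Set ℝ, IsOpen V → F x ⊆ V → ∃ U ∈ 𝓝 x, ∀ y ∈ U ∩ S, F y ⊆ V

/-- Upper semicontinuity on `[a,b]`. -/
def USCOn (a b : ℝ) (F : ℝ → Set ℝ) : Prop :=
  ∀ x ∈ Icc a b, USCWithin (Icc a b) F x

/-- Strictly increasing multifunction: `max F(x) < min F(y)` whenever `x < y` in `[a,b]`. -/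
def SIncOn (a b : ℝ) (F : ℝ → Set ℝ) : Prop :=
  ∀ x ∈ Icc a b, ∀ y ∈ Icc a b, x < y → ∀ u ∈ F x, ∀ v ∈ F y, u < v

/-- Strictly decreasing multifunction: `min F(x) > max F(y)` whenever `x < y` in `[a,b]`. -/
def SDecOn (a b : ℝ) (F : ℝ → Set ℝ) : Prop :=
  ∀ x ∈ Icc a b, ∀ y ∈ Icc a b, x < y → ∀ u ∈ F x, ∀ v ∈ F y, v < u

/-- The class 𝓕(I) of strictly monotone usc multifunctions on `I = [a,b]`. -/
def ClassF (a b : ℝ) (F : ℝ → Set ℝ) : Prop :=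
  MFOn a b F ∧ USCOn a b F ∧ (SIncOn a b F ∨ SDecOn a b F)

/-- The set `J(F)` of jumps (set-valued points) of `F` in `[a,b]`. -/
def Jumps (a b : ℝ) (F : ℝ → Set ℝ) : Set ℝ :=
  {x | x ∈ Icc a b ∧ (F x).Nontrivial}

/-- `k` is the intensity `ζ(F)`: the least `k` with `#J(F^k) = #J(F^{k+1})`. -/
def IsIntensity (a b : ℝ) (F : ℝ → Set ℝ) (k : ℕ) : Prop :=
  IsLeast {j : ℕ | (Jumps a b (Iter F j)).ncard = (Jumps a b (Iter F (j + 1))).ncard} k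

/-- Exclusive multifunctions 𝓕₁(I): members of 𝓕(I) with finitely many jumps and intensity 1. -/
def Exclusive (a b : ℝ) (F : ℝ → Set ℝ) : Prop :=
  ClassF a b F ∧ (Jumps a b F).Finite ∧ IsIntensity a b F 1

/-- Enumeration of the jumps: `c 0 = a`, `c (m+1) = b`, `c` strictly increasing on `{0,…,m+1}`,
and the jumps of `F` are exactly `c 1 < … < c m`.  The subintervals are `I_i = (c i, c (i+1))`. -/
def JumpEnum (a b : ℝ) (F : ℝ → Set ℝ) (m : ℕ) (c : ℕ → ℝ) : Prop :=
  c 0 = a ∧ c (m + 1) = b ∧ (∀ i j : ℕ, i < j → j ≤ m + 1 → c i < c j) ∧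
    Jumps a b F = {x | ∃ i : ℕ, 1 ≤ i ∧ i ≤ m ∧ x = c i}

/-- Hypothesis (H): `F` is strictly increasing, `max F(x) < x` on `(a,b)`, and `max F(b) ≤ b`. -/
def HypH (a b : ℝ) (F : ℝ → Set ℝ) : Prop :=
  SIncOn a b F ∧ (∀ x ∈ Ioo a b, ∀ u ∈ F x, u < x) ∧ (∀ u ∈ F b, u ≤ b)

/-- The orbit of a point under a monotone self-map of `{0,…,m}` reaches a fixed point within
`m` steps, with no repetition before. -/
lemma exists_iterate_fixed {m : ℕ} (hm : 1 ≤ m) {σ : Fin (m + 1) → Fin (m + 1)}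
    (hσ : Monotone σ) (i : Fin (m + 1)) :
    ∃ k, 1 ≤ k ∧ k ≤ m ∧ σ (σ^[k] i) = σ^[k] i ∧ InjOn (fun n => σ^[n] i) (Icc 1 k) := by
  have hmono : Monotone (fun n => σ^[n] i) ∨ Antitone (fun n => σ^[n] i) := by
    rcases le_total i (σ i) with h | h
    · exact Or.inl (hσ.monotone_iterate_of_le_map h)
    · exact Or.inr (hσ.antitone_iterate_of_map_le h)
  have key : ∀ p q, p < q → σ^[p] i = σ^[q] i → σ (σ^[p] i) = σ^[p] i := by
    intro p q hpq h
    rw [← Function.iterate_succ_apply' σ p i]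
    rcases hmono with hs | hs
    · exact le_antisymm ((hs (Nat.succ_le_of_lt hpq)).trans h.ge) (hs p.le_succ)
    · exact le_antisymm (hs p.le_succ) (h.le.trans (hs (Nat.succ_le_of_lt hpq)))
  have hinj : ∀ k, (∀ n < k, σ (σ^[n] i) ≠ σ^[n] i) →
      InjOn (fun n => σ^[n] i) (Finset.range (k + 1) : Set ℕ) := by
    intro k hk p hp q hq h
    simp only [Finset.coe_range, mem_Iio] at hp hq
    rcases lt_trichotomy p q with hpq | hpq | hpq
    · exact absurd (key p q hpq h) (hk p (by omega))
    · exact hpq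
    · exact absurd (key q p hpq h.symm) (hk q (by omega))
  have hbound : ∀ k, (∀ n < k, σ (σ^[n] i) ≠ σ^[n] i) → k ≤ m := by
    intro k hk
    have := Finset.card_le_card_of_injOn (t := Finset.univ) _ (fun _ _ => Finset.mem_univ _)
      (hinj k hk)
    simpa using this
  have hex : ∃ n, σ (σ^[n] i) = σ^[n] i := by
    by_contra! h
    exact absurd (hbound (m + 1) fun n _ => h n) (by omega)
  classical
  have hmin : ∀ n < Nat.find hex, σ (σ^[n] i) ≠ σ^[n] i := fun n hn => Nat.find_min hex hn
  rcases Nat.eq_zero_or_pos (Nat.find hex) with h0 | h0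
  · have h1 : σ i = i := by simpa [h0] using Nat.find_spec hex
    refine ⟨1, le_rfl, hm, by simp [h1], ?_⟩
    simp
  · refine ⟨_, h0, hbound _ hmin, Nat.find_spec hex, (hinj _ hmin).mono ?_⟩
    intro n hn
    have := hn.2
    simp only [Finset.coe_range, mem_Iio]
    omega

lemma iter_one (F : ℝ → Set ℝ) : Iter F 1 = F := by
  funext x
  simp [Iter]

lemma imageOf_mono (F : ℝ → Set ℝ) {A B : Set ℝ} (h : A ⊆ B) : ImageOf F A ⊆ ImageOf F B :=
  biUnion_subset_biUnion_left h

lemma imageOf_iter_succ (F : ℝ → Set ℝ) (n : ℕ) (A : Set ℝ) :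
    ImageOf (Iter F (n + 1)) A = ImageOf F (ImageOf (Iter F n) A) := by
  ext y
  simp only [ImageOf, Iter, mem_iUnion, exists_prop]
  constructor
  · rintro ⟨x, hx, z, hz, hy⟩
    exact ⟨z, ⟨x, hx, hz⟩, hy⟩
  · rintro ⟨z, ⟨x, hx, hz⟩, hy⟩
    exact ⟨x, hx, z, hz, hy⟩

section

variable {a b : ℝ} {F : ℝ → Set ℝ}

lemma Exclusive.jumps_nonempty (hF : Exclusive a b F) : (Jumps a b F).Nonempty := by
  obtain ⟨-, -, -, hleast⟩ := hF
  rw [nonempty_iff_ne_empty]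
  intro h
  have h0 : Jumps a b (Iter F 0) = ∅ := by
    ext x
    simp [Jumps, Iter]
  have : 1 ≤ 0 := hleast (by simp [h0, iter_one, h])
  omega

/-- For an exclusive increasing multifunction, no jump is a value at a non-jump. -/
lemma Exclusive.value_notMem_jumps (hF : Exclusive a b F) (hinc : SIncOn a b F) {x y : ℝ}
    (hx : x ∈ Icc a b) (hxJ : x ∉ Jumps a b F) (hy : y ∈ F x) : y ∉ Jumps a b F := by
  obtain ⟨⟨hMF, -⟩, hfin, hmem, -⟩ := id hF
  have hcard : (Jumps a b F).ncard = (Jumps a b (Iter F 2)).ncard := by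
    simpa [iter_one] using hmem
  have hiter : ∀ {z u v}, u ∈ F z → v ∈ F u → v ∈ Iter F 2 z := by
    intro z u v hu hv
    change v ∈ ⋃ w ∈ Iter F 1 z, F w
    rw [iter_one]
    exact mem_biUnion hu hv
  have hsub : Jumps a b F ⊆ Jumps a b (Iter F 2) := by
    rintro z ⟨hz, hnt⟩
    obtain ⟨u, hu, v, hv, huv⟩ := hnt.exists_lt
    have hu' := (hMF z hz).2.2 hu
    have hv' := (hMF z hz).2.2 hv
    obtain ⟨s, hs⟩ := (hMF u hu').1
    obtain ⟨t, ht⟩ := (hMF v hv').1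
    exact ⟨hz, s, hiter hu hs, t, hiter hv ht, (hinc u hu' v hv' huv s hs t ht).ne⟩
  have hfin2 : (Jumps a b (Iter F 2)).Finite := by
    apply finite_of_ncard_ne_zero
    rw [← hcard]
    exact (ncard_pos hfin).2 hF.jumps_nonempty |>.ne'
  have heq := eq_of_subset_of_ncard_le hsub hcard.ge hfin2
  rintro ⟨-, hnt⟩
  apply hxJ
  rw [heq]
  exact ⟨hx, hnt.mono fun v hv => hiter hy hv⟩

lemma eq_singleton_of_notMem_jumps {x y : ℝ} (hx : x ∈ Icc a b) (hxJ : x ∉ Jumps a b F)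
    (hy : y ∈ F x) : F x = {y} := by
  refine (not_nontrivial_iff.1 fun h => hxJ ⟨hx, h⟩).eq_singleton_of_mem hy

/-- A selection of a usc multifunction is continuous at interior points without jump. -/
lemma USCOn.continuousAt_selection (husc : USCOn a b F) {f : ℝ → ℝ}
    (hf : ∀ x ∈ Icc a b, f x ∈ F x) {x : ℝ} (hx : x ∈ Ioo a b) (hxJ : x ∉ Jumps a b F) :
    ContinuousAt f x := by
  have hx' := Ioo_subset_Icc_self hx
  have hFx := eq_singleton_of_notMem_jumps hx' hxJ (hf x hx')
  rw [ContinuousAt, tendsto_nhds]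
  intro V hV hfV
  obtain ⟨U, hU, h⟩ := husc x hx' V hV (by simpa [hFx] using hfV)
  filter_upwards [hU, Icc_mem_nhds hx.1 hx.2] with y hyU hy
  exact h y ⟨hyU, hy⟩ (hf y hy)

variable {m : ℕ} {c : ℕ → ℝ}

lemma JumpEnum.le (hc : JumpEnum a b F m c) {i j : ℕ} (hij : i ≤ j) (hj : j ≤ m + 1) :
    c i ≤ c j := by
  rcases hij.eq_or_lt with rfl | h
  · exact le_rfl
  · exact (hc.2.2.1 i j h hj).le

lemma JumpEnum.Ioo_subset (hc : JumpEnum a b F m c) {i : ℕ} (hi : i ≤ m) :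
    Ioo (c i) (c (i + 1)) ⊆ Ioo a b := by
  have h1 := hc.le (Nat.zero_le i) (by omega)
  have h2 := hc.le (show i + 1 ≤ m + 1 by omega) le_rfl
  rw [hc.1] at h1
  rw [hc.2.1] at h2
  exact Ioo_subset_Ioo h1 h2

lemma JumpEnum.mem_jumps (hc : JumpEnum a b F m c) {i : ℕ} (h1 : 1 ≤ i) (hm : i ≤ m) :
    c i ∈ Jumps a b F := by
  rw [hc.2.2.2]
  exact ⟨i, h1, hm, rfl⟩

lemma JumpEnum.index_le (hc : JumpEnum a b F m c) {i j : ℕ} (hi : i ≤ m) {x y : ℝ}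
    (hx : x ∈ Ioo (c i) (c (i + 1))) (hy : y ∈ Ioo (c j) (c (j + 1))) (hxy : x ≤ y) :
    i ≤ j := by
  by_contra! h
  have := hc.le (show j + 1 ≤ i by omega) (by omega)
  linarith [hx.1, hy.2]

lemma JumpEnum.notMem_jumps (hc : JumpEnum a b F m c) {i : ℕ} (hi : i ≤ m) {x : ℝ}
    (hx : x ∈ Ioo (c i) (c (i + 1))) : x ∉ Jumps a b F := by
  rw [hc.2.2.2]
  rintro ⟨j, -, hjm, rfl⟩
  rcases le_or_gt j i with h | h
  · exact (hc.le h (by omega)).not_gt hx.1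
  · exact (hc.le (show i + 1 ≤ j from h) (by omega)).not_gt hx.2

lemma JumpEnum.exists_mem_Ioo (hc : JumpEnum a b F m c) {y : ℝ} (hy : y ∈ Ioo a b)
    (hyJ : y ∉ Jumps a b F) : ∃ j ≤ m, y ∈ Ioo (c j) (c (j + 1)) := by
  have key : ∀ n ≤ m, y < c (n + 1) → ∃ j ≤ n, y ∈ Ioo (c j) (c (j + 1)) := by
    intro n
    induction n with
    | zero => exact fun _ h => ⟨0, le_rfl, by rw [hc.1]; exact hy.1, h⟩
    | succ n ih =>
      intro hn h
      rcases lt_trichotomy y (c (n + 1)) with h' | h' | h'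
      · obtain ⟨j, hj, hyj⟩ := ih (by omega) h'
        exact ⟨j, by omega, hyj⟩
      · exact absurd (h' ▸ hc.mem_jumps (by omega) hn) hyJ
      · exact ⟨n + 1, le_rfl, h', h⟩
  exact key m le_rfl (by rw [hc.2.1]; exact hy.2)

/-- Each interval between consecutive jumps is mapped into another such interval. -/
lemma Exclusive.exists_imageOf_subset (hF : Exclusive a b F) (hinc : SIncOn a b F)
    (hc : JumpEnum a b F m c) {i : ℕ} (hi : i ≤ m) :
    ∃ j ≤ m, ImageOf F (Ioo (c i) (c (i + 1))) ⊆ Ioo (c j) (c (j + 1)) := by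
  obtain ⟨hMF, husc, -⟩ := hF.1
  choose! f hf using fun x hx => (hMF x hx).1
  have hsub := hc.Ioo_subset hi
  have hsing : ∀ x ∈ Ioo (c i) (c (i + 1)), F x = {f x} := fun x hx =>
    eq_singleton_of_notMem_jumps (Ioo_subset_Icc_self (hsub hx)) (hc.notMem_jumps hi hx)
      (hf x (Ioo_subset_Icc_self (hsub hx)))
  have hnotJ : ∀ x ∈ Ioo (c i) (c (i + 1)), f x ∉ Jumps a b F := fun x hx =>
    hF.value_notMem_jumps hinc (Ioo_subset_Icc_self (hsub hx)) (hc.notMem_jumps hi hx)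
      (hf x (Ioo_subset_Icc_self (hsub hx)))
  have hmaps : ∀ x ∈ Ioo a b, f x ∈ Ioo a b := by
    intro x hx
    have hx' := Ioo_subset_Icc_self hx
    have hab := (hx.1.trans hx.2).le
    have ha := left_mem_Icc.2 hab
    have hb := right_mem_Icc.2 hab
    exact ⟨((hMF a ha).2.2 (hf a ha)).1.trans_lt (hinc a ha x hx' hx.1 _ (hf a ha) _ (hf x hx')),
      (hinc x hx' b hb hx.2 _ (hf x hx') _ (hf b hb)).trans_le ((hMF b hb).2.2 (hf b hb)).2⟩
  have hord : OrdConnected (f '' Ioo (c i) (c (i + 1))) :=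
    (isPreconnected_Ioo.image f fun x hx => (husc.continuousAt_selection hf (hsub hx)
      (hc.notMem_jumps hi hx)).continuousWithinAt).ordConnected
  have hjump : ∀ l, 1 ≤ l → l ≤ m → c l ∉ f '' Ioo (c i) (c (i + 1)) := by
    rintro l h1 hl ⟨x, hx, hxl⟩
    exact hnotJ x hx (hxl ▸ hc.mem_jumps h1 hl)
  obtain ⟨x, hx⟩ := nonempty_Ioo.2 (hc.2.2.1 i (i + 1) (by omega) (by omega))
  obtain ⟨j, hj, hxj⟩ := hc.exists_mem_Ioo (hmaps x (hsub hx)) (hnotJ x hx)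
  refine ⟨j, hj, ?_⟩
  intro y hy
  simp only [ImageOf, mem_iUnion, exists_prop] at hy
  obtain ⟨z, hz, hy⟩ := hy
  rw [hsing z hz, mem_singleton_iff] at hy
  subst hy
  have hzab := hmaps z (hsub hz)
  constructor
  · by_contra! h
    rcases Nat.eq_zero_or_pos j with rfl | hj0
    · rw [hc.1] at h
      exact h.not_gt hzab.1
    · exact hjump j hj0 hj
        (hord.out (mem_image_of_mem f hz) (mem_image_of_mem f hx) ⟨h, hxj.1.le⟩)
  · by_contra! h
    rcases hj.eq_or_lt with rfl | hjm
    · rw [hc.2.1] at h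
      exact h.not_gt hzab.2
    · exact hjump (j + 1) (by omega) hjm
        (hord.out (mem_image_of_mem f hx) (mem_image_of_mem f hz) ⟨hxj.2.le, h⟩)

lemma MFOn.imageOf_nonempty (hMF : MFOn a b F) {A : Set ℝ} (hA : A ⊆ Icc a b)
    (hne : A.Nonempty) : (ImageOf F A).Nonempty := by
  obtain ⟨x, hx⟩ := hne
  obtain ⟨y, hy⟩ := (hMF x (hA hx)).1
  exact ⟨y, mem_biUnion hx hy⟩

/-- The index map on the intervals between jumps induced by `F` is monotone. -/
lemma Exclusive.exists_monotone_index_map (hF : Exclusive a b F) (hinc : SIncOn a b F)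
    (hc : JumpEnum a b F m c) :
    ∃ σ : Fin (m + 1) → Fin (m + 1), Monotone σ ∧ ∀ i : Fin (m + 1),
      ImageOf F (Ioo (c i) (c (i + 1))) ⊆ Ioo (c (σ i)) (c (σ i + 1)) := by
  have hex : ∀ i : Fin (m + 1), ∃ j : Fin (m + 1),
      ImageOf F (Ioo (c i) (c (i + 1))) ⊆ Ioo (c j) (c (j + 1)) := by
    intro i
    obtain ⟨j, hj, h⟩ := hF.exists_imageOf_subset hinc hc (i := i) (by omega)
    exact ⟨⟨j, by omega⟩, h⟩
  choose σ hσ using hex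
  refine ⟨σ, ?_, hσ⟩
  intro i j hij
  rcases hij.eq_or_lt with rfl | hlt
  · exact le_rfl
  have hmem : ∀ i : Fin (m + 1), ∃ x ∈ Ioo (c i) (c (i + 1)), ∃ y, x ∈ Icc a b ∧ y ∈ F x ∧
      y ∈ Ioo (c (σ i)) (c (σ i + 1)) := by
    intro i
    obtain ⟨x, hx⟩ := nonempty_Ioo.2 (hc.2.2.1 i (i + 1) (by omega) (by omega))
    have hx' := Ioo_subset_Icc_self (hc.Ioo_subset (by omega) hx)
    obtain ⟨y, hy⟩ := (hF.1.1 x hx').1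
    exact ⟨x, hx, y, hx', hy, hσ i (mem_biUnion hx hy)⟩
  obtain ⟨x, hx, u, hxI, hu, hu'⟩ := hmem i
  obtain ⟨y, hy, v, hyI, hv, hv'⟩ := hmem j
  have hxy : x < y := hx.2.trans_le ((hc.le (show (i : ℕ) + 1 ≤ j from hlt) (by omega)).trans
    hy.1.le)
  exact hc.index_le (by omega) hu' hv' (hinc x hxI y hyI hxy u hu v hv).le

end

/-- existence of the absorbing correspondence `κ_F : {0,…,m} → {1,…,m}`:
for each `i` there is an absorbing interval `K ∈ Λ(F)` with (i) `F^(κ_F i)(I_i) ⊆ K`,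
(ii) `F^k(I_i) ⊄ K` for `1 ≤ k ≤ κ_F i - 1`, (iii) `F^p(I_i) ∩ F^q(I_i) = ∅` for
`1 ≤ p ≠ q ≤ κ_F i`. -/
theorem stmt6 (a b : ℝ) (hab : a < b) (F : ℝ → Set ℝ) (hF : Exclusive a b F)
    (hinc : SIncOn a b F) (m : ℕ) (c : ℕ → ℝ) (hc : JumpEnum a b F m c) :
    ∃ κ : ℕ → ℕ, ∀ i ≤ m, 1 ≤ κ i ∧ κ i ≤ m ∧
      ∃ k ≤ m,
        ImageOf F (Ioo (c k) (c (k + 1))) ⊆ Ioo (c k) (c (k + 1)) ∧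
        ImageOf (Iter F (κ i)) (Ioo (c i) (c (i + 1))) ⊆ Ioo (c k) (c (k + 1)) ∧
        (∀ j : ℕ, 1 ≤ j → j ≤ κ i - 1 →
          ¬ ImageOf (Iter F j) (Ioo (c i) (c (i + 1))) ⊆ Ioo (c k) (c (k + 1))) ∧
        (∀ p q : ℕ, 1 ≤ p → p ≤ κ i → 1 ≤ q → q ≤ κ i → p ≠ q →
          ImageOf (Iter F p) (Ioo (c i) (c (i + 1))) ∩
            ImageOf (Iter F q) (Ioo (c i) (c (i + 1))) = ∅) := by
  have hm : 1 ≤ m := by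
    obtain ⟨x, hx⟩ := hF.jumps_nonempty
    rw [hc.2.2.2] at hx
    obtain ⟨i, h1, him, -⟩ := hx
    exact h1.trans him
  obtain ⟨σ, hσ, hmap⟩ := hF.exists_monotone_index_map hinc hc
  have horbit : ∀ (n : ℕ) (i : Fin (m + 1)),
      ImageOf (Iter F n) (Ioo (c i) (c (i + 1))) ⊆
        Ioo (c (σ^[n] i : Fin (m + 1))) (c ((σ^[n] i : Fin (m + 1)) + 1)) ∧
      (ImageOf (Iter F n) (Ioo (c i) (c (i + 1)))).Nonempty := by
    intro n i
    induction n with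
    | zero =>
      have h : ImageOf (Iter F 0) (Ioo (c i) (c (i + 1))) = Ioo (c i) (c (i + 1)) := by
        simp only [ImageOf, Iter]
        exact biUnion_of_singleton _
      rw [h]
      exact ⟨subset_rfl, nonempty_Ioo.2 (hc.2.2.1 i (i + 1) (by omega) (by omega))⟩
    | succ n ih =>
      rw [imageOf_iter_succ, Function.iterate_succ_apply']
      exact ⟨(imageOf_mono F ih.1).trans (hmap _), hF.1.1.imageOf_nonempty
        (ih.1.trans ((hc.Ioo_subset (by omega)).trans Ioo_subset_Icc_self)) ih.2⟩
  have hdisj : ∀ {i j : Fin (m + 1)} {x : ℝ}, x ∈ Ioo (c i) (c (i + 1)) →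
      x ∈ Ioo (c j) (c (j + 1)) → i = j := fun {i j x} hi hj =>
    le_antisymm (hc.index_le (by omega) hi hj le_rfl) (hc.index_le (by omega) hj hi le_rfl)
  choose κ h1 hκm hfix hinj using exists_iterate_fixed hm hσ
  refine ⟨fun i => if h : i < m + 1 then κ ⟨i, h⟩ else 0, fun i hi => ?_⟩
  have hi' : i < m + 1 := by omega
  obtain ⟨i, rfl⟩ : ∃ i' : Fin (m + 1), (i' : ℕ) = i := ⟨⟨i, hi'⟩, rfl⟩
  simp only [hi', dif_pos, Fin.eta]
  refine ⟨h1 i, hκm i, (σ^[κ i] i : Fin (m + 1)), by omega, ?_, (horbit (κ i) i).1, ?_, ?_⟩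
  · have h := hmap (σ^[κ i] i)
    rwa [hfix i] at h
  · intro j hj1 hj hsub
    have hκ := h1 i
    obtain ⟨x, hx⟩ := (horbit j i).2
    have := hinj i ⟨hj1, by omega⟩ ⟨hκ, le_rfl⟩ (hdisj ((horbit j i).1 hx) (hsub hx))
    omega
  · intro p q hp1 hp hq1 hq hpq
    rw [← not_nonempty_iff_eq_empty]
    rintro ⟨x, hxp, hxq⟩
    exact hpq (hinj i ⟨hp1, hp⟩ ⟨hq1, hq⟩
      (hdisj ((horbit p i).1 hxp) ((horbit q i).1 hxq)))
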